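/- Let ρ : ℝ → ℝ be C^∞ with 0 ≤ ρ ≤ 1, ρ(t) = 1 for t < 1/2 and ρ(t) = 0 for t > 1. Let m ≥ 1, c ∈ ℂ^m, and let A_b^{αβ} : B̄₂ → ℂ^{m×m} be bounded measurable coefficients whose operator norms are bounded by a constant M; set A_c = F_*A_b on B₂ \ B̄₁. For ε ∈ (0,1) define φ_ε : B₂ \ B̄₁ → ℂ^m by φ_ε(y) = ρ( ln ε / ln(|y|−1) )·c. Then lim_{ε→0⁺} ∫_{B₂ \ B̄₁} Σ_{α,β=1}^2 (A_c^{αβ}(y) ∂_β φ_ε(y))* ∂_α φ_ε(y) dy = 0. -/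

import Mathlib

noncomputable section
open Metric Matrix MeasureTheory Filter

/-- The blow-up map `F(x) = (1 + |x|/2) x/|x|`. -/
def Fmap (x : EuclideanSpace ℝ (Fin 2)) : EuclideanSpace ℝ (Fin 2) :=
  ((1 + ‖x‖ / 2) * ‖x‖⁻¹) • x

/-- Its inverse `y ↦ 2(|y| - 1) y/|y|` on `B₂ \ B̄₁`. -/
def Gmap (y : EuclideanSpace ℝ (Fin 2)) : EuclideanSpace ℝ (Fin 2) :=
  ((2 * (‖y‖ - 1)) * ‖y‖⁻¹) • y

/-- Standard basis vectors of `ℝ²`. -/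
def eb (i : Fin 2) : EuclideanSpace ℝ (Fin 2) := EuclideanSpace.single i 1

/-- `i`-th partial derivative of a `ℂ^m`-valued function. -/
def pd {m : ℕ} (i : Fin 2) (u : EuclideanSpace ℝ (Fin 2) → Fin m → ℂ)
    (x : EuclideanSpace ℝ (Fin 2)) : Fin m → ℂ :=
  fun p => fderiv ℝ (fun z => u z p) x (eb i)

/-- Jacobian determinant `det [∂F_i/∂x_j]` of a map `F : ℝ² → ℝ²`. -/
def Jdet (F : EuclideanSpace ℝ (Fin 2) → EuclideanSpace ℝ (Fin 2))
    (x : EuclideanSpace ℝ (Fin 2)) : ℝ :=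
  Matrix.det (Matrix.of fun i j => fderiv ℝ (fun z => F z i) x (eb j))

/-- Push-forward of the matrix coefficients `A = [A^{αβ}]` under `F` (with inverse `Finv`). -/
def pushA {m : ℕ} (F Finv : EuclideanSpace ℝ (Fin 2) → EuclideanSpace ℝ (Fin 2))
    (A : Fin 2 → Fin 2 → EuclideanSpace ℝ (Fin 2) → Matrix (Fin m) (Fin m) ℂ)
    (p q : Fin 2) (y : EuclideanSpace ℝ (Fin 2)) : Matrix (Fin m) (Fin m) ℂ :=
  ∑ α : Fin 2, ∑ β : Fin 2,
    ((fderiv ℝ (fun z => F z p) (Finv y) (eb β) *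
        fderiv ℝ (fun z => F z q) (Finv y) (eb α) * (Jdet F (Finv y))⁻¹ : ℝ)) •
      A α β (Finv y)

/-- The cut-off test family `φ_ε(y) = ρ(ln ε / ln(|y|−1)) c`. -/
def φfam {m : ℕ} (ρ : ℝ → ℝ) (c : Fin m → ℂ) (ε : ℝ)
    (y : EuclideanSpace ℝ (Fin 2)) : Fin m → ℂ :=
  ρ (Real.log ε / Real.log (‖y‖ - 1)) • c

lemma norm_sq_two (y : EuclideanSpace ℝ (Fin 2)) : ‖y‖ ^ 2 = y 0 ^ 2 + y 1 ^ 2 := by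
  rw [EuclideanSpace.norm_sq_eq]; simp [Fin.sum_univ_two]

lemma hasFDerivAt_nrm (x : EuclideanSpace ℝ (Fin 2)) (hx : x ≠ 0) :
    HasFDerivAt (fun z : EuclideanSpace ℝ (Fin 2) => ‖z‖) (‖x‖⁻¹ • innerSL ℝ x) x := by
  have h1 : HasFDerivAt (fun z : EuclideanSpace ℝ (Fin 2) => ‖z‖ ^ 2) (2 • innerSL ℝ x) x :=
    (hasStrictFDerivAt_norm_sq x).hasFDerivAt
  have hn : ‖x‖ ≠ 0 := norm_ne_zero_iff.mpr hx
  have h2 := h1.sqrt (by positivity)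
  simp only [Real.sqrt_sq (norm_nonneg _)] at h2
  have e : ‖x‖⁻¹ • innerSL ℝ x = (1 / (2 * ‖x‖)) • (2 • innerSL ℝ x) := by
    rw [two_nsmul, ← two_smul ℝ (innerSL ℝ x), smul_smul]
    congr 1
    field_simp
  rw [e]
  exact h2

lemma inner_eb (x : EuclideanSpace ℝ (Fin 2)) (j : Fin 2) : innerSL ℝ x (eb j) = x j := by
  simp [eb, innerSL_apply_apply, EuclideanSpace.inner_single_right]

lemma fderiv_Fmap (x : EuclideanSpace ℝ (Fin 2)) (hx : x ≠ 0) (p b : Fin 2) :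
    fderiv ℝ (fun z => Fmap z p) x (eb b) =
      (‖x‖⁻¹ + 1 / 2) * (if p = b then 1 else 0) - (‖x‖⁻¹) ^ 3 * x b * x p := by
  have hn : ‖x‖ ≠ 0 := norm_ne_zero_iff.mpr hx
  have h := hasFDerivAt_nrm x hx
  have hc : HasFDerivAt (fun z : EuclideanSpace ℝ (Fin 2) => z p) (EuclideanSpace.proj p : EuclideanSpace ℝ (Fin 2) →L[ℝ] ℝ) x :=
    (EuclideanSpace.proj p : EuclideanSpace ℝ (Fin 2) →L[ℝ] ℝ).hasFDerivAt
  have hi : HasFDerivAt (fun z : EuclideanSpace ℝ (Fin 2) => ‖z‖⁻¹) ((-(‖x‖ ^ 2)⁻¹) • (‖x‖⁻¹ • innerSL ℝ x)) x :=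
    (hasDerivAt_inv hn).comp_hasFDerivAt x h
  have hall := (((h.mul_const (1 / 2)).const_add 1).mul hi).mul hc
  have e : (fun z => Fmap z p) = fun z : EuclideanSpace ℝ (Fin 2) => ((1 + ‖z‖ * (1 / 2)) * ‖z‖⁻¹) * z p := by
    funext z; simp [Fmap]; left; left; ring
  have hall' := hall.fderiv
  rw [e]
  erw [hall']
  have hb := inner_eb x b
  have hpb : (EuclideanSpace.proj p : EuclideanSpace ℝ (Fin 2) →L[ℝ] ℝ) (eb b) = if p = b then 1 else 0 := by
    simp [eb]
  simp only [_root_.add_apply, _root_.smul_apply, hb, hpb, smul_eq_mul, Pi.mul_apply]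
  field_simp
  ring

lemma pd_fam {m : ℕ} (ρ : ℝ → ℝ) (hρ : Differentiable ℝ ρ) (c : Fin m → ℂ) (ε : ℝ) (y : EuclideanSpace ℝ (Fin 2))
    (h1 : 1 < ‖y‖) (h2 : ‖y‖ < 2) (i : Fin 2) :
    pd i (φfam ρ c ε) y =
      ((deriv ρ (Real.log ε / Real.log (‖y‖ - 1)) *
        (-Real.log ε / (Real.log (‖y‖ - 1)) ^ 2 * (‖y‖ - 1)⁻¹) * (‖y‖⁻¹ * y i) : ℝ) : ℂ) • c := by
  have hy : y ≠ 0 := by rintro rfl; simp at h1; linarith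
  have hl : Real.log (‖y‖ - 1) ≠ 0 := (Real.log_neg (by linarith) (by linarith)).ne
  have h := hasFDerivAt_nrm y hy
  have hlog : HasDerivAt (fun r : ℝ => Real.log ε / Real.log (r - 1))
      (-Real.log ε / (Real.log (‖y‖ - 1)) ^ 2 * (‖y‖ - 1)⁻¹) ‖y‖ := by
    have := (hasDerivAt_const ‖y‖ (Real.log ε)).div
      (((hasDerivAt_id ‖y‖).sub_const 1).log (by simp; linarith)) (by simpa using hl)
    refine this.congr_deriv ?_
    simp only [id]
    ring
  have h3 := ((hρ _).hasDerivAt.comp ‖y‖ hlog).comp_hasFDerivAt y h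
  funext p
  have h4 := (h3.smul_const (c p)).fderiv
  have e : (fun z => φfam ρ c ε z p) =
    fun z : EuclideanSpace ℝ (Fin 2) => ((ρ ∘ fun r : ℝ => Real.log ε / Real.log (r - 1)) ∘ fun z : EuclideanSpace ℝ (Fin 2) => ‖z‖) z • c p := by
    funext z; simp [φfam]
  unfold pd
  rw [e, h4]
  simp only [ContinuousLinearMap.smulRight_apply, _root_.smul_apply, inner_eb]
  simp

lemma bilin_bound {m : ℕ} (A : Matrix (Fin m) (Fin m) ℂ) (c : Fin m → ℂ) (M : ℝ)
    (h : Real.sqrt (∑ p : Fin m, ‖(A.mulVec c) p‖ ^ 2) ≤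
        M * Real.sqrt (∑ p : Fin m, ‖c p‖ ^ 2)) :
    ‖star (A.mulVec c) ⬝ᵥ c‖ ≤ ∑ p, M * Real.sqrt (∑ p : Fin m, ‖c p‖ ^ 2) * ‖c p‖ := by
  unfold dotProduct
  refine (norm_sum_le _ _).trans (Finset.sum_le_sum fun p _ => ?_)
  rw [norm_mul, Pi.star_apply, norm_star]
  gcongr
  refine le_trans ?_ h
  apply Real.le_sqrt_of_sq_le
  exact Finset.single_le_sum (f := fun p => ‖(A.mulVec c) p‖ ^ 2) (fun _ _ => by positivity)
    (Finset.mem_univ p)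

lemma alg_id (k e0 e1 v : ℝ) (he : e0 ^ 2 + e1 ^ 2 = 1) (hk : 0 < k) (D : Fin 2 → Fin 2 → ℝ)
    (hD : ∀ p b, D p b = (k + 1 / 2) * (if p = b then 1 else 0) - k * ![e0, e1] b * ![e0, e1] p)
    {m : ℕ} (A : Fin 2 → Fin 2 → Matrix (Fin m) (Fin m) ℂ) (c : Fin m → ℂ) :
    (∑ p : Fin 2, ∑ q : Fin 2,
      star ((∑ α : Fin 2, ∑ β : Fin 2,
        ((D p β * D q α * (Matrix.det (Matrix.of D))⁻¹ : ℝ)) • A α β).mulVec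
          (((v * ![e0, e1] q : ℝ) : ℂ) • c)) ⬝ᵥ (((v * ![e0, e1] p : ℝ) : ℂ) • c)) =
    ∑ α : Fin 2, ∑ β : Fin 2, ((v ^ 2 / (2 * (k + 1 / 2)) * (![e0, e1] α * ![e0, e1] β) : ℝ) : ℂ) *
      (star ((A α β).mulVec c) ⬝ᵥ c) := by
  have hdet : Matrix.det (Matrix.of D) = (k + 1 / 2) / 2 := by
    rw [Matrix.det_fin_two]
    simp [hD]
    linear_combination (-k * (k + 1 / 2)) * he
  have hs : ∀ b, ∑ p, ![e0, e1] p * D p b = ![e0, e1] b / 2 := by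
    intro b
    fin_cases b <;> simp [hD, Fin.sum_univ_two]
    · linear_combination (-k * e0) * he
    · linear_combination (-k * e1) * he
  rw [hdet]
  set J := ((k + 1 / 2) / 2)⁻¹ with hJ
  have h1 : ∀ p q : Fin 2, star ((∑ α : Fin 2, ∑ β : Fin 2,
        ((D p β * D q α * J : ℝ)) • A α β).mulVec
          (((v * ![e0, e1] q : ℝ) : ℂ) • c)) ⬝ᵥ (((v * ![e0, e1] p : ℝ) : ℂ) • c) =
      ∑ α : Fin 2, ∑ β : Fin 2, ((v ^ 2 * J * ((![e0, e1] p * D p β) * (![e0, e1] q * D q α)) : ℝ) : ℂ) *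
      (star ((A α β).mulVec c) ⬝ᵥ c) := by
    intro p q
    simp only [Fin.sum_univ_two, Matrix.add_mulVec, Matrix.smul_mulVec, Matrix.mulVec_smul,
      star_add, star_smul, add_dotProduct, smul_dotProduct, dotProduct_smul, Complex.real_smul,
      smul_eq_mul, Complex.star_def, Complex.conj_ofReal, star_trivial]
    push_cast
    ring
  simp only [h1]
  have h2 : ∀ α β, (v ^ 2 / (2 * (k + 1 / 2)) * (![e0, e1] α * ![e0, e1] β) : ℝ) =
      v ^ 2 * J * ((∑ p, ![e0, e1] p * D p β) * (∑ p, ![e0, e1] p * D p α)) := by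
    intro a b
    rw [hs, hs, hJ]; field_simp
  simp only [h2]
  simp only [Fin.sum_univ_two]
  push_cast
  ring

lemma integrand_bound {m : ℕ} (ρ : ℝ → ℝ) (hρ : Differentiable ℝ ρ) (c : Fin m → ℂ) (ε : ℝ)
    (Ab : Fin 2 → Fin 2 → EuclideanSpace ℝ (Fin 2) → Matrix (Fin m) (Fin m) ℂ)
    (C : ℝ) (hC : ∀ α β x, ‖star ((Ab α β x).mulVec c) ⬝ᵥ c‖ ≤ C)
    (y : EuclideanSpace ℝ (Fin 2)) (h1 : 1 < ‖y‖) (h2 : ‖y‖ < 2) :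
    ‖∑ α : Fin 2, ∑ β : Fin 2,
            star ((pushA Fmap Gmap Ab α β y).mulVec (pd β (φfam ρ c ε) y)) ⬝ᵥ
              pd α (φfam ρ c ε) y‖ ≤
      4 * C * (deriv ρ (Real.log ε / Real.log (‖y‖ - 1)) *
        (-Real.log ε / (Real.log (‖y‖ - 1)) ^ 2 * (‖y‖ - 1)⁻¹)) ^ 2 * (‖y‖ - 1) := by
  have hC0 : 0 ≤ C := (norm_nonneg _).trans (hC 0 0 0)
  set v := deriv ρ (Real.log ε / Real.log (‖y‖ - 1)) *
        (-Real.log ε / (Real.log (‖y‖ - 1)) ^ 2 * (‖y‖ - 1)⁻¹) with hv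
  have hy0 : ‖y‖ ≠ 0 := by linarith
  have hs : 0 < ‖y‖ - 1 := by linarith
  have hG : ‖Gmap y‖ = 2 * (‖y‖ - 1) := by
    rw [Gmap, norm_smul, Real.norm_of_nonneg (by positivity)]
    field_simp
  have hG0 : Gmap y ≠ 0 := by
    rw [← norm_ne_zero_iff, hG]; positivity
  have hGi : ∀ i, Gmap y i = 2 * (‖y‖ - 1) * (‖y‖⁻¹ * y i) := by
    intro i; simp [Gmap]; ring
  set k := (2 * (‖y‖ - 1))⁻¹ with hk
  have hk0 : 0 < k := by positivity
  set e0 := ‖y‖⁻¹ * y 0 with he0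
  set e1 := ‖y‖⁻¹ * y 1 with he1
  have hei : ∀ i, ‖y‖⁻¹ * y i = ![e0, e1] i := by
    intro i; fin_cases i <;> rfl
  have he : e0 ^ 2 + e1 ^ 2 = 1 := by
    have := norm_sq_two y
    rw [he0, he1]; field_simp; linarith
  have key := alg_id k e0 e1 v he hk0 (fun p b => fderiv ℝ (fun z => Fmap z p) (Gmap y) (eb b))
    (by
      intro p b
      rw [fderiv_Fmap _ hG0, hG, hGi, hGi, hei, hei, ← hk]
      have : (2 * (‖y‖ - 1)) = k⁻¹ := by rw [hk, inv_inv]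
      rw [this]; field_simp) (fun α β => Ab α β (Gmap y)) c
  have e : (∑ α : Fin 2, ∑ β : Fin 2,
            star ((pushA Fmap Gmap Ab α β y).mulVec (pd β (φfam ρ c ε) y)) ⬝ᵥ
              pd α (φfam ρ c ε) y) =
      ∑ α : Fin 2, ∑ β : Fin 2, ((v ^ 2 / (2 * (k + 1 / 2)) * (![e0, e1] α * ![e0, e1] β) : ℝ) : ℂ) *
      (star ((Ab α β (Gmap y)).mulVec c) ⬝ᵥ c) := by
    simp only [pd_fam ρ hρ c ε y h1 h2, ← hv, hei, pushA, Jdet]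
    exact key
  rw [e]
  have hab : ∀ α β, ‖((v ^ 2 / (2 * (k + 1 / 2)) * (![e0, e1] α * ![e0, e1] β) : ℝ) : ℂ) *
      (star ((Ab α β (Gmap y)).mulVec c) ⬝ᵥ c)‖ ≤ v ^ 2 * (‖y‖ - 1) * C := by
    intro α β
    rw [norm_mul, Complex.norm_real]
    have ha : ∀ i, |![e0, e1] i| ≤ 1 := by
      intro i
      have q0 : |e0| ≤ 1 := (sq_le_one_iff_abs_le_one e0).mp (by nlinarith [sq_nonneg e1])
      have q1 : |e1| ≤ 1 := (sq_le_one_iff_abs_le_one e1).mp (by nlinarith [sq_nonneg e0])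
      fin_cases i
      · exact q0
      · exact q1
    gcongr
    · rw [norm_mul, norm_mul, Real.norm_of_nonneg (by positivity), Real.norm_eq_abs,
        Real.norm_eq_abs]
      have h3 : |![e0, e1] α| * |![e0, e1] β| ≤ 1 :=
        mul_le_one₀ (ha α) (abs_nonneg _) (ha β)
      have h4 : v ^ 2 / (2 * (k + 1 / 2)) ≤ v ^ 2 * (‖y‖ - 1) := by
        rw [div_le_iff₀ (by positivity)]
        have : (‖y‖ - 1) * (2 * (k + 1 / 2)) = 1 + (‖y‖ - 1) := by
          rw [hk]; field_simp
        rw [mul_assoc, this]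
        nlinarith [sq_nonneg v]
      calc _ ≤ v ^ 2 * (‖y‖ - 1) * 1 := by gcongr
        _ = _ := mul_one _
    · exact hC _ _ _
  refine (norm_sum_le _ _).trans ?_
  refine (Finset.sum_le_sum fun α _ => (norm_sum_le _ _).trans
    (Finset.sum_le_sum fun β _ => hab α β)).trans ?_
  simp
  linarith

/-- Radial majorant. -/
def gmaj (D ε : ℝ) (r : ℝ) : ℝ :=
  (Set.Ioc (1 + ε ^ 2) (1 + ε)).indicator (fun r => D / (Real.log ε) ^ 2 * (r⁻¹ * (r - 1)⁻¹)) r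

lemma deriv_zero_of (ρ : ℝ → ℝ)
    (hρ1 : ∀ t < (1 / 2 : ℝ), ρ t = 1) (hρ0 : ∀ t > (1 : ℝ), ρ t = 0) (t : ℝ)
    (ht : t < 1 / 2 ∨ 1 < t) : deriv ρ t = 0 := by
  rcases ht with ht | ht
  · have : ρ =ᶠ[nhds t] fun _ => 1 := by
      filter_upwards [Iio_mem_nhds ht] with s hs using hρ1 s hs
    rw [this.deriv_eq]; simp
  · have : ρ =ᶠ[nhds t] fun _ => 0 := by
      filter_upwards [Ioi_mem_nhds ht] with s hs using hρ0 s hs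
    rw [this.deriv_eq]; simp

lemma maj_bound (ρ : ℝ → ℝ)
    (hz : ∀ t, t ≤ 1 / 2 ∨ 1 < t → deriv ρ t = 0)
    (K C : ℝ) (hC : 0 ≤ C) (hK : ∀ t, |deriv ρ t| ≤ K) (ε : ℝ) (hε : 0 < ε) (hε1 : ε < 1)
    (r : ℝ) (h1 : 1 < r) (h2 : r < 2) :
    4 * C * (deriv ρ (Real.log ε / Real.log (r - 1)) *
        (-Real.log ε / (Real.log (r - 1)) ^ 2 * (r - 1)⁻¹)) ^ 2 * (r - 1)
      ≤ gmaj (8 * C * K ^ 2) ε r := by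
  have hs : 0 < r - 1 := by linarith
  have hl : Real.log (r - 1) < 0 := Real.log_neg hs (by linarith)
  have hL : Real.log ε < 0 := Real.log_neg hε hε1
  unfold gmaj
  by_cases hr : r ∈ Set.Ioc (1 + ε ^ 2) (1 + ε)
  · rw [Set.indicator_of_mem hr]
    have hll : Real.log (r - 1) ≤ Real.log ε := Real.log_le_log hs (by linarith [hr.2])
    set l := Real.log (r - 1)
    set L := Real.log ε
    set d := deriv ρ (L / l)
    have hd : d ^ 2 ≤ K ^ 2 := sq_le_sq' (abs_le.mp (hK _)).1 (abs_le.mp (hK _)).2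
    have hq : L ^ 2 ≤ l ^ 2 := by nlinarith
    have hL2 : 0 < L ^ 2 := sq_pos_of_neg hL
    have hl2 : 0 < l ^ 2 := sq_pos_of_neg hl
    have h5 : (-L / l ^ 2) ^ 2 ≤ 1 / L ^ 2 := by
      rw [div_pow, neg_sq, div_le_div_iff₀ (by positivity) hL2]
      nlinarith
    have h6 : (1 : ℝ) ≤ 2 * r⁻¹ := by
      rw [← div_eq_mul_inv, le_div_iff₀ (by linarith)]; linarith
    calc 4 * C * (d * (-L / l ^ 2 * (r - 1)⁻¹)) ^ 2 * (r - 1)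
        = 4 * C * (d ^ 2 * (-L / l ^ 2) ^ 2 * (r - 1)⁻¹) * 1 := by field_simp
      _ ≤ 4 * C * (K ^ 2 * (1 / L ^ 2) * (r - 1)⁻¹) * (2 * r⁻¹) := by gcongr
      _ = _ := by ring
  · rw [Set.indicator_of_notMem hr]
    have : deriv ρ (Real.log ε / Real.log (r - 1)) = 0 := by
      apply hz
      rw [Set.mem_Ioc, not_and_or, not_lt, not_le] at hr
      rcases hr with hr | hr
      · left
        have := Real.log_le_log hs (show r - 1 ≤ ε ^ 2 by linarith)
        rw [Real.log_pow] at this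
        push_cast at this
        rw [div_le_iff_of_neg hl]; linarith
      · right
        have := Real.log_lt_log hε (show ε < r - 1 by linarith)
        rw [lt_div_iff_of_neg hl]; linarith
    rw [this]; simp

lemma maj_integral (D ε : ℝ) (hε : 0 < ε) (hε1 : ε < 1) :
    Integrable (fun y : EuclideanSpace ℝ (Fin 2) => gmaj D ε ‖y‖) ∧
    ∫ y : EuclideanSpace ℝ (Fin 2), gmaj D ε ‖y‖ =
      2 * (volume.real (ball (0 : EuclideanSpace ℝ (Fin 2)) 1)) * D * (-(Real.log ε)⁻¹) := by
  have hL : Real.log ε < 0 := Real.log_neg hε hε1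
  have hle : 1 + ε ^ 2 ≤ 1 + ε := by nlinarith
  have e : ∀ y : ℝ, y ^ (Module.finrank ℝ (EuclideanSpace ℝ (Fin 2)) - 1) • gmaj D ε y =
      (Set.Ioc (1 + ε ^ 2) (1 + ε)).indicator (fun r => D / (Real.log ε) ^ 2 * (r - 1)⁻¹) y := by
    intro y
    unfold gmaj
    by_cases hy : y ∈ Set.Ioc (1 + ε ^ 2) (1 + ε)
    · rw [Set.indicator_of_mem hy, Set.indicator_of_mem hy]
      have : y ≠ 0 := by have := hy.1; nlinarith [sq_nonneg ε]
      simp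
      field_simp
    · rw [Set.indicator_of_notMem hy, Set.indicator_of_notMem hy]; simp
  have hsub : Set.Ioi (0 : ℝ) ∩ Set.Ioc (1 + ε ^ 2) (1 + ε) = Set.Ioc (1 + ε ^ 2) (1 + ε) := by
    apply Set.inter_eq_right.mpr
    intro y hy
    have := hy.1
    simp only [Set.mem_Ioi]; nlinarith
  have hII : IntervalIntegrable (fun r : ℝ => D / (Real.log ε) ^ 2 * (r - 1)⁻¹) volume
      (1 + ε ^ 2) (1 + ε) := by
    apply ContinuousOn.intervalIntegrable
    rw [Set.uIcc_of_le hle]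
    apply ContinuousOn.mul continuousOn_const
    apply ContinuousOn.inv₀ (by fun_prop)
    intro x hx
    have := hx.1
    have : 0 < ε ^ 2 := by positivity
    intro h; linarith
  constructor
  · rw [integrable_fun_norm_addHaar volume (f := gmaj D ε)]
    simp only [e]
    apply Integrable.integrableOn
    rw [integrable_indicator_iff measurableSet_Ioc]
    exact (intervalIntegrable_iff_integrableOn_Ioc_of_le hle).mp hII
  · rw [integral_fun_norm_addHaar volume (gmaj D ε)]
    simp only [e]
    rw [setIntegral_indicator measurableSet_Ioc, hsub, ← intervalIntegral.integral_of_le hle,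
      intervalIntegral.integral_const_mul,
      intervalIntegral.integral_comp_sub_right (fun x => x⁻¹) 1]
    simp only [add_sub_cancel_left]
    rw [integral_inv_of_pos (by positivity) hε, Real.log_div hε.ne' (by positivity), Real.log_pow]
    have := hL.ne
    simp
    field_simp
    ring

/-- for the cut-off family `φ_ε(y) = ρ(ln ε/ln(|y|−1)) c`, the gradient part of
the cloaking energy tends to `0`:
`lim_{ε→0⁺} ∫_{B₂\B̄₁} Σ_{α,β} (A_c^{αβ} ∂_β φ_ε)* ∂_α φ_ε dy = 0`. -/
theorem stmt_17 {m : ℕ} (hm : 1 ≤ m)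
    (ρ : ℝ → ℝ) (hρ : ContDiff ℝ (⊤ : ℕ∞) ρ) (hρ01 : ∀ t, 0 ≤ ρ t ∧ ρ t ≤ 1)
    (hρ1 : ∀ t < (1 / 2 : ℝ), ρ t = 1) (hρ0 : ∀ t > (1 : ℝ), ρ t = 0)
    (c : Fin m → ℂ)
    (Ab : Fin 2 → Fin 2 → EuclideanSpace ℝ (Fin 2) → Matrix (Fin m) (Fin m) ℂ)
    (hAmeas : ∀ α β p q, Measurable fun x => Ab α β x p q)
    (M : ℝ)
    (hAop : ∀ (x : EuclideanSpace ℝ (Fin 2)) (α β : Fin 2) (ξ : Fin m → ℂ),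
      Real.sqrt (∑ p : Fin m, ‖((Ab α β x).mulVec ξ) p‖ ^ 2) ≤
        M * Real.sqrt (∑ p : Fin m, ‖ξ p‖ ^ 2)) :
    Tendsto (fun ε : ℝ =>
        ∫ y in ball (0 : EuclideanSpace ℝ (Fin 2)) 2 \ closedBall 0 1,
          ∑ α : Fin 2, ∑ β : Fin 2,
            star ((pushA Fmap Gmap Ab α β y).mulVec (pd β (φfam ρ c ε) y)) ⬝ᵥ
              pd α (φfam ρ c ε) y)
      (nhdsWithin 0 (Set.Ioi 0)) (nhds (0 : ℂ)) := by
  have hd : Differentiable ℝ ρ := hρ.differentiable (by simp)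
  have hdc : Continuous (deriv ρ) := hρ.continuous_deriv (by simp)
  have hz0 := deriv_zero_of ρ hρ1 hρ0
  have hz : ∀ t, t ≤ 1 / 2 ∨ 1 < t → deriv ρ t = 0 := by
    have hcl : IsClosed {t | deriv ρ t = 0} := isClosed_eq hdc continuous_const
    have hsub : Set.Iio (1 / 2 : ℝ) ⊆ {t | deriv ρ t = 0} := fun t ht => hz0 t (Or.inl ht)
    have h3 := closure_minimal hsub hcl
    rw [closure_Iio] at h3
    rintro t (ht | ht)
    · exact h3 ht
    · exact hz0 t (Or.inr ht)
  obtain ⟨K, hK⟩ : ∃ K, ∀ t, |deriv ρ t| ≤ K := by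
    obtain ⟨K, hK⟩ := (isCompact_Icc (a := (1 / 2 : ℝ)) (b := 1)).exists_bound_of_continuousOn
      hdc.continuousOn
    refine ⟨max K 0, fun t => ?_⟩
    by_cases ht : t ∈ Set.Icc (1 / 2 : ℝ) 1
    · exact (hK t ht).trans (le_max_left _ _)
    · rw [Set.mem_Icc, not_and_or, not_le, not_le] at ht
      rw [hz0 t ht]; simp
  set C := ∑ p, M * Real.sqrt (∑ p : Fin m, ‖c p‖ ^ 2) * ‖c p‖
  have hC : ∀ α β x, ‖star ((Ab α β x).mulVec c) ⬝ᵥ c‖ ≤ C :=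
    fun α β x => bilin_bound _ c M (hAop x α β c)
  have hC0 : 0 ≤ C := (norm_nonneg _).trans (hC 0 0 0)
  have hlim : Tendsto (fun ε : ℝ => 2 * (volume.real (ball (0 : EuclideanSpace ℝ (Fin 2)) 1)) *
      (8 * C * K ^ 2) * (-(Real.log ε)⁻¹)) (nhdsWithin 0 (Set.Ioi 0)) (nhds 0) := by
    have h := (tendsto_inv_atBot_zero.comp Real.tendsto_log_nhdsGT_zero).neg.const_mul
      (2 * (volume.real (ball (0 : EuclideanSpace ℝ (Fin 2)) 1)) * (8 * C * K ^ 2))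
    simpa using h
  refine squeeze_zero_norm' ?_ hlim
  have hev : ∀ᶠ ε : ℝ in nhdsWithin 0 (Set.Ioi 0), ε ∈ Set.Ioo (0 : ℝ) 1 :=
    Ioo_mem_nhdsGT one_pos
  filter_upwards [hev] with ε hε
  obtain ⟨hint, hval⟩ := maj_integral (8 * C * K ^ 2) ε hε.1 hε.2
  rw [← hval]
  refine (norm_integral_le_of_norm_le hint.integrableOn ?_).trans
    (setIntegral_le_integral hint (Eventually.of_forall fun y => ?_))
  · refine (ae_restrict_iff' (measurableSet_ball.diff measurableSet_closedBall)).mpr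
      (Eventually.of_forall fun y hy => ?_)
    have h2 : ‖y‖ < 2 := by simpa using hy.1
    have h1 : 1 < ‖y‖ := by simpa using hy.2
    exact (integrand_bound ρ hd c ε Ab C hC y h1 h2).trans
      (maj_bound ρ hz K C hC0 hK ε hε.1 hε.2 ‖y‖ h1 h2)
  · apply Set.indicator_nonneg
    intro r hr
    have h1 : 1 < r := lt_of_le_of_lt (by nlinarith [sq_nonneg ε]) hr.1
    have h2 : 0 < r - 1 := by linarith
    have h3 : 0 < r := by linarith
    positivity
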